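/- Let H be a limit sparse numerical semigroup with even Frobenius number ℓ_g = 2g - 2r (so g = 4r - 1 and ℓ_g = 6r - 2). Then H = 3ℕ + H_{6r-2}, i.e., H = {3k : k ∈ ℕ, 3k ≤ 6r - 3} ∪ {n ∈ ℕ : n ≥ 6r - 1}. -/

import Mathlib

/-- `H` is a numerical semigroup of genus `g`: it contains `0`, is closed under
addition, and its complement in `ℕ` (the set of gaps) is finite with exactly
`g` elements. -/
def IsNumericalSemigroupOfGenus (H : Set ℕ) (g : ℕ) : Prop :=
  0 ∈ H ∧ (∀ a ∈ H, ∀ b ∈ H, a + b ∈ H) ∧ Hᶜ.Finite ∧ Hᶜ.ncard = g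

/-- The `i`-th gap `ℓ_i` of `H` (1-indexed): the `i`-th smallest element of `ℕ \ H`.
In particular, if `H` has genus `g`, then `gap H g` is the Frobenius number of `H`. -/
noncomputable def gap (H : Set ℕ) (i : ℕ) : ℕ :=
  Nat.nth (fun n => n ∉ H) (i - 1)

/-- A numerical semigroup `H` of genus `g` is sparse if any two subsequent gaps
differ by at most `2`. -/
def IsSparse (H : Set ℕ) (g : ℕ) : Prop :=
  ∀ i, 1 ≤ i → i ≤ g - 1 → gap H (i + 1) - gap H i ≤ 2

/-- `D`, the number of double leaps of `H` (of genus `g`). -/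
noncomputable def numDouble (H : Set ℕ) (g : ℕ) : ℕ :=
  {i : ℕ | 1 ≤ i ∧ i ≤ g - 1 ∧ gap H (i + 1) - gap H i = 2}.ncard

/-- `S`, the number of single leaps of `H` (of genus `g`). -/
noncomputable def numSingle (H : Set ℕ) (g : ℕ) : ℕ :=
  {i : ℕ | 1 ≤ i ∧ i ≤ g - 1 ∧ gap H (i + 1) - gap H i = 1}.ncard

open Finset in
/-- The core of the argument: if `B`, the set of elements of `H` below its even Frobenius
number `F`, satisfies `3 |B| = F + 2`, then `3 ∈ H`. -/
theorem three_mem_of_card {H : Set ℕ} [DecidablePred (· ∈ H)] {F : ℕ} (h0 : 0 ∈ H)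
    (hadd : ∀ a ∈ H, ∀ b ∈ H, a + b ∈ H) (hFH : F ∉ H) (hFe : Even F)
    (hiso : ∀ a, a < F → a ∈ H → a + 1 ∉ H) (h1 : 1 ∉ H)
    (hcard : 3 * #{x ∈ range (F + 1) | x ∈ H} = F + 2) : 3 ∈ H := by
  have hmul : ∀ m ∈ H, ∀ t, m * t ∈ H := by
    intro m hm t
    induction t with
    | zero => simpa using h0
    | succ t ih => exact hadd _ ih _ hm
  obtain ⟨f, hf⟩ := hFe
  have h2 : 2 ∉ H := fun h => hFH (by simpa [hf, two_mul] using hmul 2 h f)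
  have hF0 : F ≠ 0 := fun h => hFH (h ▸ h0)
  set B : Finset ℕ := {x ∈ range (F + 1) | x ∈ H} with hB
  have memB : ∀ x, x ∈ B ↔ x ≤ F ∧ x ∈ H := by intro x; simp [hB]
  set P : Finset ℕ := {x ∈ Icc 2 F | x ∉ H ∧ x - 1 ∉ H} with hP
  have memP : ∀ x, x ∈ P ↔ (2 ≤ x ∧ x ≤ F) ∧ x ∉ H ∧ x - 1 ∉ H := by intro x; simp [hP]
  have cardP : #P + 1 = #B := by
    have hunion : range (F + 1) = (B ∪ B.image (· + 1)) ∪ P := by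
      ext x
      simp only [mem_union, mem_image, memB, memP, mem_range]
      constructor
      · intro hx
        by_cases hxH : x ∈ H
        · exact Or.inl (Or.inl ⟨by omega, hxH⟩)
        · have hx0 : x ≠ 0 := fun h => hxH (h ▸ h0)
          by_cases hx1 : x - 1 ∈ H
          · exact Or.inl (Or.inr ⟨x - 1, ⟨by omega, hx1⟩, by omega⟩)
          · have : x - 1 ≠ 0 := fun h => hx1 (h ▸ h0)
            exact Or.inr ⟨⟨by omega, by omega⟩, hxH, hx1⟩
      · rintro ((h | ⟨y, h, rfl⟩) | h)
        · omega
        · have : y ≠ F := fun e => hFH (e ▸ h.2)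
          omega
        · omega
    have hd1 : Disjoint B (B.image (· + 1)) := by
      rw [disjoint_left]
      intro x hx hx'
      obtain ⟨y, hy, rfl⟩ := mem_image.1 hx'
      rw [memB] at hx hy
      exact hiso y (by omega) hy.2 hx.2
    have hd2 : Disjoint (B ∪ B.image (· + 1)) P := by
      rw [disjoint_left]
      intro x hx hx'
      rw [memP] at hx'
      rcases mem_union.1 hx with h | h
      · exact hx'.2.1 ((memB x).1 h).2
      · obtain ⟨y, hy, rfl⟩ := mem_image.1 h
        exact hx'.2.2 (by simpa using ((memB y).1 hy).2)
    have := congrArg card hunion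
    rw [card_union_of_disjoint hd2, card_union_of_disjoint hd1,
      card_image_of_injective _ (add_left_injective 1), card_range] at this
    omega
  -- the largest element `x` of `P`, and the alternating pattern of `H` on `[x, F]`
  have hPne : P.Nonempty := ⟨2, (memP 2).2 ⟨⟨le_rfl, by omega⟩, h2, by simpa using h1⟩⟩
  obtain ⟨x, hxP, hxmax⟩ : ∃ x ∈ P, ∀ y ∈ P, y ≤ x :=
    ⟨P.max' hPne, P.max'_mem hPne, fun y hy => P.le_max' y hy⟩
  obtain ⟨⟨hx2, hxF⟩, hxH, hx1H⟩ := (memP x).1 hxP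
  have hodd : ∀ j, x + 2 * j ∉ H → x + 2 * j + 1 ≤ F → x + 2 * j + 1 ∈ H := by
    intro j hj hle
    by_contra hc
    have := hxmax (x + 2 * j + 1) ((memP _).2 ⟨⟨by omega, hle⟩, hc, by simpa using hj⟩)
    omega
  have heven : ∀ j, x + 2 * j ≤ F → x + 2 * j ∉ H := by
    intro j
    induction j with
    | zero => intro _; simpa using hxH
    | succ j ih =>
      intro hle
      exact hiso (x + 2 * j + 1) (by omega) (hodd j (ih (by omega)) (by omega))
  replace hodd : ∀ j, x + 2 * j + 1 ≤ F → x + 2 * j + 1 ∈ H :=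
    fun j hle => hodd j (heven j (by omega)) hle
  obtain ⟨k, hk⟩ : ∃ k, F = x + 2 * k := by
    refine ⟨(F - x) / 2, ?_⟩
    by_contra hc
    have := hodd ((F - x) / 2) (by omega)
    rw [show x + 2 * ((F - x) / 2) + 1 = F by omega] at this
    exact hFH this
  set B₁ : Finset ℕ := {y ∈ range (x - 1) | y ∈ H} with hB₁
  have memB₁ : ∀ y, y ∈ B₁ ↔ y < x - 1 ∧ y ∈ H := by intro y; simp [hB₁]
  have cardB : #B ≤ #B₁ + k := by
    have hsub : B ⊆ B₁ ∪ (range k).image (fun j => x + 2 * j + 1) := by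
      intro y hy
      rw [memB] at hy
      rw [mem_union, memB₁, mem_image]
      by_cases hlt : y < x - 1
      · exact Or.inl ⟨hlt, hy.2⟩
      · right
        have e1 : y ≠ x - 1 := fun e => hx1H (e ▸ hy.2)
        have e2 : ¬ ∃ j, y = x + 2 * j := by
          rintro ⟨j, rfl⟩
          exact heven j hy.1 hy.2
        have e3 : y ≠ x + 2 * ((y - x) / 2) := fun e => e2 ⟨_, e⟩
        exact ⟨(y - x) / 2, mem_range.2 (by omega), by omega⟩
    calc #B ≤ _ := card_le_card hsub
      _ ≤ _ := card_union_le _ _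
      _ ≤ #B₁ + k := by
        gcongr
        exact card_image_le.trans (by simp)
  set Q : Finset ℕ := P \ B₁.image (fun b => x - b) with hQ
  have cardQ : #Q + 1 ≤ k := by
    have hsub : B₁.image (fun b => x - b) ⊆ P := by
      intro y hy
      obtain ⟨b, hb, rfl⟩ := mem_image.1 hy
      rw [memB₁] at hb
      refine (memP _).2 ⟨⟨by omega, by omega⟩, fun h => hxH ?_, fun h => hx1H ?_⟩
      · have := hadd _ h _ hb.2
        rwa [show x - b + b = x by omega] at this
      · have := hadd _ h _ hb.2
        rwa [show x - b - 1 + b = x - 1 by omega] at this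
    have hinj : #(B₁.image (fun b => x - b)) = #B₁ := by
      apply card_image_of_injOn
      intro a ha b hb hab
      have ha := ((memB₁ a).1 ha).1
      have hb := ((memB₁ b).1 hb).1
      simp only at hab
      omega
    have := card_sdiff_add_card_eq_card hsub
    rw [← hQ] at this
    omega
  have memQ : ∀ p, 2 ≤ p → p ≤ x → p ∉ H → p - 1 ∉ H → x - p ∉ H → p ∈ Q := by
    intro p hp2 hpx hp hp1 hxp
    rw [hQ, mem_sdiff, memP, mem_image]
    refine ⟨⟨⟨hp2, by omega⟩, hp, hp1⟩, ?_⟩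
    rintro ⟨b, hb, rfl⟩
    rw [memB₁] at hb
    apply hxp
    rw [show x - (x - b) = b by omega]
    exact hb.2
  -- the multiplicity `m` of `H`
  have hxk : x + 1 ∈ H := by simpa using hodd 0 (by omega)
  obtain ⟨m, ⟨hm0, hmH⟩, hmin⟩ : ∃ m, (0 < m ∧ m ∈ H) ∧ ∀ y, 0 < y → y ∈ H → m ≤ y :=
    have hex : ∃ m, 0 < m ∧ m ∈ H := ⟨x + 1, by omega, hxk⟩
    ⟨Nat.find hex, Nat.find_spec hex, fun y hy hyH => Nat.find_min' hex ⟨hy, hyH⟩⟩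
  have hmx : m ≤ x + 1 := hmin _ (by omega) hxk
  have hm1 : m ≠ 1 := fun h => h1 (h ▸ hmH)
  have hm2 : m ≠ 2 := fun h => h2 (h ▸ hmH)
  -- `Q` contains an element of every pair `{a, a + 1}` of integers in `[2, m)`
  have hpair : ∀ a, 2 ≤ a → a + 1 < m →
      (if x - a ∈ H then a + 1 else a) ∈ Q := by
    intro a ha ham
    have hgap : ∀ y, 0 < y → y < m → y ∉ H := fun y hy hym hyH => by
      have := hmin y hy hyH
      omega
    split_ifs with h
    · refine memQ _ (by omega) (by omega) (hgap _ (by omega) ham)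
        (hgap _ (by omega) (by omega)) fun h' => hiso _ (by omega) h' ?_
      rwa [show x - (a + 1) + 1 = x - a by omega]
    · exact memQ _ ha (by omega) (hgap _ (by omega) (by omega))
        (hgap _ (by omega) (by omega)) h
  have hblocks : ∀ j n : ℕ, 2 * n + 2 + (if j ≤ n then 1 else 0) ≤ m →
      ∃ T ⊆ Q, #T = n ∧ ∀ z ∈ T, z < m ∧ z ≠ 2 * j := by
    intro j n hn
    set a : ℕ → ℕ := fun i => if i + 1 < j then 2 + 2 * i else 3 + 2 * i with ha
    set φ : ℕ → ℕ := fun i => if x - a i ∈ H then a i + 1 else a i with hφ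
    have hφa : ∀ i, φ i = a i ∨ φ i = a i + 1 := by
      intro i
      simp only [hφ]
      split_ifs <;> simp
    have haj : ∀ i, (i + 1 < j ∧ a i = 2 + 2 * i) ∨ (j ≤ i + 1 ∧ a i = 3 + 2 * i) := by
      intro i
      simp only [ha]
      split_ifs with h
      · exact Or.inl ⟨h, rfl⟩
      · exact Or.inr ⟨by omega, rfl⟩
    have ham : ∀ i < n, 2 ≤ a i ∧ a i + 1 < m := by
      intro i hi
      have := haj i
      split_ifs at hn <;> omega
    refine ⟨(range n).image φ, ?_, ?_, ?_⟩
    · intro z hz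
      obtain ⟨i, hi, rfl⟩ := mem_image.1 hz
      have := ham i (mem_range.1 hi)
      exact hpair (a i) this.1 this.2
    · rw [card_image_of_injective, card_range]
      intro i i' hii
      have := haj i
      have := haj i'
      have := hφa i
      have := hφa i'
      omega
    · intro z hz
      obtain ⟨i, hi, rfl⟩ := mem_image.1 hz
      have := ham i (mem_range.1 hi)
      have := haj i
      have := hφa i
      omega
  -- hence `m = 2k + 1`
  have hlow : m ≤ 2 * k + 1 := by
    obtain ⟨T, hTQ, hT, -⟩ := hblocks (m / 2) (m / 2 - 1) (by rw [if_neg] <;> omega)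
    have := card_le_card hTQ
    omega
  have hmk : m = 2 * k + 1 := by
    rcases Nat.even_or_odd m with ⟨c, hc⟩ | ⟨c, hc⟩
    · exfalso
      have hdm := Nat.div_add_mod F m
      have hlt := Nat.mod_lt F hm0
      have hdvd : 2 ∣ F % m := (Nat.dvd_mod_iff ⟨c, by omega⟩).2 ⟨f, by omega⟩
      obtain ⟨t, ht⟩ := hdvd
      apply heven (k - t) (by omega)
      rw [show x + 2 * (k - t) = m * (F / m) by omega]
      exact hmul m hmH _
    · by_contra hne
      have := hodd (k - c - 1) (by omega)
      have := hadd _ this _ hmH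
      rw [show x + 2 * (k - c - 1) + 1 + m = F by omega] at this
      exact hFH this
  by_contra h3
  have hk2 : 2 ≤ k := by
    have : m ≠ 3 := fun h => h3 (h ▸ hmH)
    omega
  have hnotQ : ∀ j, 1 ≤ j → j ≤ k → ∀ z ∈ Q, z < m ∧ z ≠ 2 * j := by
    intro j hj1 hjk
    obtain ⟨T, hTQ, hT, hTz⟩ := hblocks j (k - 1) (by split_ifs <;> omega)
    have : T = Q := eq_of_subset_of_card_le hTQ (by omega)
    rwa [this] at hTz
  have hxe : ∀ j, 1 ≤ j → j ≤ k → x - 2 * j ∈ H := by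
    intro j hj1 hjk
    by_contra hc
    refine (hnotQ j hj1 hjk (2 * j) (memQ _ (by omega) (by omega) ?_ ?_ hc)).2 rfl
    · intro h
      have := hmin _ (by omega) h
      omega
    · intro h
      have := hmin _ (by omega) h
      omega
  have hx_2 := hmin _ (by omega) (hxe 1 le_rfl (by omega))
  have hx_m := hmin _ (by omega) (hxe k (by omega) le_rfl)
  have hstep : ∀ j, 2 ≤ j → j ≤ k → m + 2 * j - 2 ∈ H := by
    intro j hj2 hjk
    by_contra hc
    have hxj := hxe j (by omega) hjk
    refine absurd (hnotQ 1 le_rfl (by omega) (m + 2 * j - 1)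
      (memQ _ (by omega) (by omega) (fun h => hFH ?_) (fun h => hc ?_) fun h => ?_)).1 (by omega)
    · have := hadd _ h _ hxj
      rwa [show m + 2 * j - 1 + (x - 2 * j) = F by omega] at this
    · rwa [show m + 2 * j - 1 - 1 = m + 2 * j - 2 by omega] at h
    · apply hiso _ (by omega) hxj
      have := hadd _ h _ hmH
      rwa [show x - (m + 2 * j - 1) + m = x - 2 * j + 1 by omega] at this
  have ha := hadd _ (hstep 2 le_rfl hk2) _ (hstep k hk2 le_rfl)
  rw [show m + 2 * 2 - 2 + (m + 2 * k - 2) = 3 * m - 1 by omega] at ha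
  have hb := hmul m hmH 3
  have e1 : F ≠ 3 * m - 1 := fun e => hFH (e ▸ ha)
  refine hiso _ (by omega) ha ?_
  rwa [show 3 * m - 1 + 1 = m * 3 by omega]

section Gaps

variable {H : Set ℕ} {g : ℕ}

theorem IsNumericalSemigroupOfGenus.card_toFinset (hH : IsNumericalSemigroupOfGenus H g)
    (hf : (Set.ofPred fun n => n ∉ H).Finite) : hf.toFinset.card = g := by
  rw [← Set.ncard_eq_toFinset_card _ hf]
  exact hH.2.2.2

theorem IsNumericalSemigroupOfGenus.gap_notMem (hH : IsNumericalSemigroupOfGenus H g) {i : ℕ}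
    (hi : 1 ≤ i) (hig : i ≤ g) : gap H i ∉ H :=
  Nat.nth_mem (p := fun n => n ∉ H) (i - 1) fun hf => by
    rw [hH.card_toFinset hf]
    omega

theorem IsNumericalSemigroupOfGenus.gap_lt_gap (hH : IsNumericalSemigroupOfGenus H g) {i j : ℕ}
    (hi : 1 ≤ i) (hij : i < j) (hjg : j ≤ g) : gap H i < gap H j :=
  Nat.nth_lt_nth' (by omega) fun hf => by
    rw [hH.card_toFinset hf]
    omega

theorem IsNumericalSemigroupOfGenus.exists_gap_eq (hH : IsNumericalSemigroupOfGenus H g) {n : ℕ}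
    (hn : n ∉ H) : ∃ i, 1 ≤ i ∧ i ≤ g ∧ gap H i = n := by
  obtain ⟨i, hi, rfl⟩ := Nat.exists_lt_card_finite_nth_eq (p := fun n => n ∉ H) hH.2.2.1 hn
  rw [hH.card_toFinset] at hi
  exact ⟨i + 1, by omega, by omega, rfl⟩

theorem IsNumericalSemigroupOfGenus.le_gap_genus (hH : IsNumericalSemigroupOfGenus H g) {n : ℕ}
    (hn : n ∉ H) : n ≤ gap H g := by
  obtain ⟨i, hi, hig, rfl⟩ := hH.exists_gap_eq hn
  rcases hig.eq_or_lt with rfl | h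
  · rfl
  · exact (hH.gap_lt_gap hi h le_rfl).le

theorem IsNumericalSemigroupOfGenus.one_notMem (hH : IsNumericalSemigroupOfGenus H g)
    (hg : g ≠ 0) : 1 ∉ H := by
  intro h1
  have hall : ∀ n, n ∈ H := by
    intro n
    induction n with
    | zero => exact hH.1
    | succ n ih => exact hH.2.1 _ ih _ h1
  exact hH.gap_notMem (Nat.one_le_iff_ne_zero.2 hg) le_rfl (hall _)

theorem IsNumericalSemigroupOfGenus.gap_one (hH : IsNumericalSemigroupOfGenus H g)
    (hg : g ≠ 0) : gap H 1 = 1 := by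
  have hpos : gap H 1 ≠ 0 := fun h => hH.gap_notMem le_rfl (by omega) (h ▸ hH.1)
  obtain ⟨i, hi, hig, h⟩ := hH.exists_gap_eq (hH.one_notMem hg)
  rcases hi.eq_or_lt with rfl | hlt
  · exact h
  · have := hH.gap_lt_gap le_rfl hlt hig
    omega

/-- Below its Frobenius number, a sparse semigroup has no two consecutive elements. -/
theorem IsSparse.succ_notMem (hs : IsSparse H g) (hH : IsNumericalSemigroupOfGenus H g)
    {a : ℕ} (ha : a < gap H g) (haH : a ∈ H) : a + 1 ∉ H := by
  intro ha1
  have hg : g ≠ 0 := by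
    rintro rfl
    have hall : ∀ n, n ∈ H := by
      intro n
      by_contra hn
      obtain ⟨i, _, _, _⟩ := hH.exists_gap_eq hn
      omega
    have h0 : gap H 0 = 0 :=
      Nat.nth_of_card_le (p := fun n => n ∉ H) hH.2.2.1 (by rw [hH.card_toFinset])
    omega
  have hex : ∃ i, a < gap H i ∧ 1 ≤ i := ⟨g, ha, by omega⟩
  obtain ⟨hi, hi1⟩ := Nat.find_spec hex
  have hig : Nat.find hex ≤ g := Nat.find_min' hex ⟨ha, by omega⟩
  have hmin := fun j (hj : j < Nat.find hex) => Nat.find_min hex hj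
  generalize Nat.find hex = i at hi hi1 hig hmin
  have hgi := hH.gap_notMem hi1 hig
  have hne : gap H i ≠ a + 1 := fun e => hgi (e ▸ ha1)
  rcases hi1.eq_or_lt with rfl | hlt
  · have := hH.gap_one hg
    omega
  · have hj := hmin (i - 1) (by omega)
    have hgj : gap H (i - 1) ≠ a := fun e =>
      hH.gap_notMem (i := i - 1) (by omega) (by omega) (e ▸ haH)
    have hstep := hs (i - 1) (by omega) (by omega)
    rw [show i - 1 + 1 = i by omega] at hstep
    omega

open Finset in
/-- The leaps of a sparse semigroup add up to the distance between its extreme gaps. -/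
theorem IsSparse.numSingle_add_numDouble (hs : IsSparse H g)
    (hH : IsNumericalSemigroupOfGenus H g) (hg : g ≠ 0) :
    numSingle H g + numDouble H g + 1 = g ∧
      numSingle H g + 2 * numDouble H g + 1 = gap H g := by
  have key : ∀ c, {i : ℕ | 1 ≤ i ∧ i ≤ g - 1 ∧ gap H (i + 1) - gap H i = c}.ncard =
      #{i ∈ range (g - 1) | gap H (i + 2) - gap H (i + 1) = c} := by
    intro c
    rw [← card_image_of_injective _ (add_left_injective 1), ← Set.ncard_coe_finset]
    congr 1
    ext i
    simp only [Set.mem_ofPred_eq, coe_image, coe_filter, mem_range, Set.mem_image]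
    constructor
    · rintro ⟨h1, h2, h3⟩
      refine ⟨i - 1, ⟨by omega, ?_⟩, by omega⟩
      rw [show i - 1 + 2 = i + 1 by omega, show i - 1 + 1 = i by omega]
      exact h3
    · rintro ⟨j, ⟨h1, h2⟩, rfl⟩
      exact ⟨by omega, by omega, h2⟩
  have hrec : ∀ n, n + 1 ≤ g →
      #{i ∈ range n | gap H (i + 2) - gap H (i + 1) = 1} +
        #{i ∈ range n | gap H (i + 2) - gap H (i + 1) = 2} = n ∧
      #{i ∈ range n | gap H (i + 2) - gap H (i + 1) = 1} +
        2 * #{i ∈ range n | gap H (i + 2) - gap H (i + 1) = 2} + 1 = gap H (n + 1) := by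
    intro n
    induction n with
    | zero => simp [hH.gap_one hg]
    | succ n ih =>
      intro hn
      obtain ⟨ih1, ih2⟩ := ih (by omega)
      have hlt := hH.gap_lt_gap (i := n + 1) (j := n + 2) (by omega) (by omega) hn
      have hle : gap H (n + 2) - gap H (n + 1) ≤ 2 := hs (n + 1) (by omega) (by omega)
      rw [range_add_one, filter_insert, filter_insert, show n + 1 + 1 = n + 2 from rfl]
      split_ifs with h1 h2 h2
      · omega
      · rw [card_insert_of_notMem (by simp)]
        omega
      · rw [card_insert_of_notMem (by simp)]
        omega
      · omega
  obtain ⟨hc, hl⟩ := hrec (g - 1) (by omega)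
  rw [show g - 1 + 1 = g by omega] at hl
  unfold numSingle numDouble
  rw [key, key]
  omega

open Finset in
theorem IsNumericalSemigroupOfGenus.card_filter_mem [DecidablePred (· ∈ H)]
    (hH : IsNumericalSemigroupOfGenus H g) :
    #{x ∈ range (gap H g + 1) | x ∈ H} + g = gap H g + 1 := by
  have hgaps : #{x ∈ range (gap H g + 1) | x ∉ H} = g := by
    rw [← Set.ncard_coe_finset]
    refine Eq.trans (congrArg Set.ncard ?_) hH.2.2.2
    ext x
    simp only [coe_filter, mem_range, Set.mem_ofPred_eq, Set.mem_compl_iff]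
    exact ⟨And.right, fun h => ⟨Nat.lt_succ_of_le (hH.le_gap_genus h), h⟩⟩
  have := card_filter_add_card_filter_not (s := range (gap H g + 1)) (· ∈ H)
  rw [hgaps, card_range] at this
  exact this

end Gaps

/-- **Theorem.** Let `H` be a limit sparse numerical semigroup with even Frobenius
number `ℓ_g = 2g - 2r`. Then `H = 3ℕ + H_{6r-2}`, i.e.
`H = {3k : 3k ≤ 6r - 3} ∪ {n : n ≥ 6r - 1}`. -/
theorem charact_limit_sparse_even (H : Set ℕ) (g r : ℕ) (hg : 1 < g)
    (hH : IsNumericalSemigroupOfGenus H g) (hs : IsSparse H g)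
    (hlim : numSingle H g = numDouble H g)
    (hF : gap H g = 2 * g - 2 * r) :
    H = {n : ℕ | ∃ k, n = 3 * k ∧ 3 * k ≤ 6 * r - 3} ∪ {n : ℕ | 6 * r - 1 ≤ n} := by
  classical
  obtain ⟨hg1, hg2⟩ := hs.numSingle_add_numDouble hH (by omega)
  have hFr : gap H g = 6 * r - 2 ∧ 1 ≤ r := by omega
  have h3 : 3 ∈ H := by
    have hcard := hH.card_filter_mem
    exact three_mem_of_card hH.1 hH.2.1 (hH.gap_notMem (by omega) le_rfl)
      ⟨g - r, by omega⟩ (fun a ha haH => hs.succ_notMem hH ha haH)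
      (hH.one_notMem (by omega)) (by omega)
  have hmul : ∀ k, 3 * k ∈ H := by
    intro k
    induction k with
    | zero => exact hH.1
    | succ k ih => exact hH.2.1 _ ih _ h3
  ext x
  simp only [Set.mem_union, Set.mem_ofPred_eq]
  constructor
  · intro hx
    by_contra! hc
    have hne : x ≠ gap H g := fun e => hH.gap_notMem (by omega) le_rfl (e ▸ hx)
    have h0 : x ≠ 3 * (x / 3) := fun h => by
      have := hc.1 (x / 3) h
      omega
    rcases (by omega : x = 3 * (x / 3) + 1 ∨ x + 1 = 3 * (x / 3 + 1)) with h | h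
    · exact hs.succ_notMem hH (by omega) (hmul (x / 3)) (h ▸ hx)
    · exact hs.succ_notMem hH (by omega) hx (h ▸ hmul (x / 3 + 1))
  · rintro (⟨k, rfl, -⟩ | hx)
    · exact hmul k
    · by_contra hxH
      have := hH.le_gap_genus hxH
      omega
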